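/- Let w : ℝⁿ × (-∞, 0] → ℝ be a smooth solution of the heat equation w_t = Δw on ℝⁿ × (-∞,0), and suppose there exist constants C > 0 and p ∈ (1,∞) such that for all s ≥ 1, ( s^{-(n+2+2p)} ∫_{Q_s^-} |w|^p dx dt )^{1/p} ≤ C ln(2s). Then w is a polynomial of degree at most 2 in the spatial variables and at most 1 in time, i.e. w(x,t) = a + b·x + ½ xᵀ M x + m t with ΔP = P_t, where M is a symmetric matrix with trace equal to m. -/

import Mathlib

open MeasureTheory Set Filter

noncomputable section

abbrev Esp (n : ℕ) := EuclideanSpace ℝ (Fin n)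

/-- The backward parabolic cylinder `Q_r^- = B_r(0) × (-r², 0]`. -/
def Qneg (n : ℕ) (r : ℝ) : Set (Esp n × ℝ) :=
  {q | ‖q.1‖ < r ∧ q.2 ∈ Set.Ioc (-(r^2)) 0}

/-- Spatial partial derivative in the `i`-th direction. -/
def pderiv' {n : ℕ} (i : Fin n) (g : Esp n → ℝ) (x : Esp n) : ℝ :=
  deriv (fun s : ℝ => g (x + s • (EuclideanSpace.single i (1:ℝ)))) 0

/-- The Laplacian as the sum of pure second spatial derivatives. -/
def lapl {n : ℕ} (g : Esp n → ℝ) (x : Esp n) : ℝ :=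
  ∑ i, pderiv' i (pderiv' i g) x

/-- The heat operator `H u = Δu - u_t`. -/
def heatOp {n : ℕ} (u : Esp n × ℝ → ℝ) (q : Esp n × ℝ) : ℝ :=
  lapl (fun x => u (x, q.2)) q.1 - deriv (fun t => u (q.1, t)) q.2

namespace CaloricLiouville

/-- The open backward half-space `ℝⁿ × (-∞, 0)`. -/
def past (n : ℕ) : Set (Esp n × ℝ) := {q | q.2 < 0}

/-- The derivative of `g` in the direction `e`. -/
def dirDeriv {n : ℕ} (e : Esp n × ℝ) (g : Esp n × ℝ → ℝ) (q : Esp n × ℝ) : ℝ := fderiv ℝ g q e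

/-- The `i`-th spatial direction. -/
def spaceDir {n : ℕ} (i : Fin n) : Esp n × ℝ := (EuclideanSpace.single i 1, 0)

/-- The time direction. -/
def timeDir (n : ℕ) : Esp n × ℝ := (0, 1)

/-- Smooth solutions of the heat equation on `ℝⁿ × (-∞, 0)`. -/
structure IsCaloric {n : ℕ} (v : Esp n × ℝ → ℝ) : Prop where
  contDiffOn : ContDiffOn ℝ (⊤ : ℕ∞) v (past n)
  heat : ∀ q ∈ past n,
    ∑ i, dirDeriv (spaceDir i) (dirDeriv (spaceDir i) v) q = dirDeriv (timeDir n) v q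

variable {n : ℕ}

lemma isOpen_past : IsOpen (past n) := isOpen_lt continuous_snd continuous_const

lemma isPreconnected_past : IsPreconnected (past n) := by
  have : past n = (univ : Set (Esp n)) ×ˢ Iio (0 : ℝ) := by ext; simp [past]
  rw [this]
  exact isPreconnected_univ.prod isPreconnected_Iio

lemma contDiffOn_dirDeriv {g : Esp n × ℝ → ℝ} (e : Esp n × ℝ)
    (hg : ContDiffOn ℝ (⊤ : ℕ∞) g (past n)) :
    ContDiffOn ℝ (⊤ : ℕ∞) (dirDeriv e g) (past n) :=
  (hg.fderiv_of_isOpen isOpen_past (by simp)).clm_apply contDiffOn_const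

lemma contDiff_dirDeriv {g : Esp n × ℝ → ℝ} (e : Esp n × ℝ)
    (hg : ContDiff ℝ (⊤ : ℕ∞) g) : ContDiff ℝ (⊤ : ℕ∞) (dirDeriv e g) :=
  (hg.fderiv_right (by simp)).clm_apply contDiff_const

lemma contDiffAt_of_mem {g : Esp n × ℝ → ℝ} (hg : ContDiffOn ℝ (⊤ : ℕ∞) g (past n))
    {q : Esp n × ℝ} (hq : q ∈ past n) : ContDiffAt ℝ (⊤ : ℕ∞) g q :=
  hg.contDiffAt (isOpen_past.mem_nhds hq)

lemma differentiableAt_of_mem {g : Esp n × ℝ → ℝ} (hg : ContDiffOn ℝ (⊤ : ℕ∞) g (past n))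
    {q : Esp n × ℝ} (hq : q ∈ past n) : DifferentiableAt ℝ g q :=
  (contDiffAt_of_mem hg hq).differentiableAt (by simp)

lemma dirDeriv_congr {g h : Esp n × ℝ → ℝ} (e : Esp n × ℝ) (hgh : EqOn g h (past n)) :
    EqOn (dirDeriv e g) (dirDeriv e h) (past n) := fun q hq => by
  have : g =ᶠ[nhds q] h := Filter.eventuallyEq_of_mem (isOpen_past.mem_nhds hq) hgh
  simp only [dirDeriv, this.fderiv_eq]

lemma dirDeriv_comm {g : Esp n × ℝ → ℝ} (hg : ContDiffOn ℝ (⊤ : ℕ∞) g (past n))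
    (e f : Esp n × ℝ) : EqOn (dirDeriv e (dirDeriv f g)) (dirDeriv f (dirDeriv e g)) (past n) := by
  intro q hq
  have hd : DifferentiableAt ℝ (fderiv ℝ g) q :=
    ((contDiffAt_of_mem hg hq).fderiv_right (m := (⊤ : ℕ∞)) (by simp)).differentiableAt (by simp)
  have key : ∀ a b : Esp n × ℝ, dirDeriv a (dirDeriv b g) q = fderiv ℝ (fderiv ℝ g) q a b := by
    intro a b
    have := (hd.hasFDerivAt.clm_apply (hasFDerivAt_const b q)).fderiv
    change fderiv ℝ (fun y => fderiv ℝ g y b) q a = _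
    rw [this]
    simp
  rw [key, key]
  exact (contDiffAt_of_mem hg hq).isSymmSndFDerivAt
    (by simpa using WithTop.coe_le_coe.2 (le_top (a := (2 : ℕ∞)))) e f

lemma dirDeriv_sum {g : Fin n → Esp n × ℝ → ℝ} (e : Esp n × ℝ)
    (hg : ∀ i, ContDiffOn ℝ (⊤ : ℕ∞) (g i) (past n)) {q : Esp n × ℝ} (hq : q ∈ past n) :
    dirDeriv e (fun q => ∑ i, g i q) q = ∑ i, dirDeriv e (g i) q := by
  simp only [dirDeriv]
  rw [fderiv_fun_sum fun i _ => differentiableAt_of_mem (hg i) hq]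
  simp

lemma IsCaloric.dirDeriv {v : Esp n × ℝ → ℝ} (hv : IsCaloric v) (e : Esp n × ℝ) :
    IsCaloric (dirDeriv e v) := by
  refine ⟨contDiffOn_dirDeriv e hv.contDiffOn, fun q hq => ?_⟩
  rw [dirDeriv_comm hv.contDiffOn (timeDir n) e hq]
  rw [← dirDeriv_congr e (fun q hq => hv.heat q hq) hq, dirDeriv_sum e
    (fun i => contDiffOn_dirDeriv _ (contDiffOn_dirDeriv _ hv.contDiffOn)) hq]
  refine Finset.sum_congr rfl fun i _ => ?_
  rw [dirDeriv_congr (spaceDir i) (dirDeriv_comm hv.contDiffOn (spaceDir i) e) hq,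
    dirDeriv_comm (contDiffOn_dirDeriv _ hv.contDiffOn) (spaceDir i) e hq]

lemma fderiv_eq_zero_of_dirDeriv {g : Esp n × ℝ → ℝ} {q : Esp n × ℝ}
    (hs : ∀ i, dirDeriv (spaceDir i) g q = 0) (ht : dirDeriv (timeDir n) g q = 0) :
    fderiv ℝ g q = 0 := by
  ext y
  · have hy : ((EuclideanSpace.basisFun (Fin n) ℝ).toBasis.constr ℝ fun _ => (0 : ℝ)) = 0 := by
      apply (EuclideanSpace.basisFun (Fin n) ℝ).toBasis.ext; simp
    have : (fderiv ℝ g q ∘L ContinuousLinearMap.inl ℝ (Esp n) ℝ : Esp n →ₗ[ℝ] ℝ) = 0 := by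
      apply (EuclideanSpace.basisFun (Fin n) ℝ).toBasis.ext
      intro i
      simpa [dirDeriv, spaceDir] using hs i
    simpa using LinearMap.congr_fun this y
  · simpa [dirDeriv, timeDir] using ht

/-- A smooth function with vanishing first derivatives is constant on the half-space. -/
lemma exists_eq_const {g : Esp n × ℝ → ℝ} (hg : ContDiffOn ℝ (⊤ : ℕ∞) g (past n))
    (hs : ∀ i, ∀ q ∈ past n, dirDeriv (spaceDir i) g q = 0)
    (ht : ∀ q ∈ past n, dirDeriv (timeDir n) g q = 0) : ∃ c, ∀ q ∈ past n, g q = c :=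
  isOpen_past.exists_is_const_of_fderiv_eq_zero isPreconnected_past
    (hg.differentiableOn (by simp))
    fun q hq => fderiv_eq_zero_of_dirDeriv (fun i => hs i q hq) (ht q hq)

lemma dirDeriv_eq_zero_of_const {g : Esp n × ℝ → ℝ} {c : ℝ} (e : Esp n × ℝ)
    (hg : ∀ q ∈ past n, g q = c) : ∀ q ∈ past n, dirDeriv e g q = 0 := fun q hq => by
  rw [dirDeriv_congr e (h := fun _ => c) hg hq]
  simp [dirDeriv]

/-- A caloric function with vanishing spatial gradient is constant. -/
lemma IsCaloric.exists_eq_const {v : Esp n × ℝ → ℝ} (hv : IsCaloric v)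
    (hs : ∀ i, ∀ q ∈ past n, CaloricLiouville.dirDeriv (spaceDir i) v q = 0) :
    ∃ c, ∀ q ∈ past n, v q = c := by
  refine CaloricLiouville.exists_eq_const hv.contDiffOn hs fun q hq => ?_
  rw [← hv.heat q hq]
  exact Finset.sum_eq_zero fun i _ => dirDeriv_eq_zero_of_const _ (hs i) q hq

instance isAddHaarMeasure_volume : (volume : Measure (Esp n × ℝ)).IsAddHaarMeasure :=
  inferInstanceAs ((volume : Measure (Esp n)).prod (volume : Measure ℝ)).IsAddHaarMeasure

lemma integrable_mul_of_tsupport {h Φ : Esp n × ℝ → ℝ} (hh : ContinuousOn h (past n))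
    (hΦ : Continuous Φ) (hc : HasCompactSupport Φ) (hs : tsupport Φ ⊆ past n) :
    Integrable (fun q => h q * Φ q) := by
  have hi : IntegrableOn (fun q => h q * Φ q) (tsupport Φ) :=
    ((hh.mono hs).mul hΦ.continuousOn).integrableOn_compact hc
  rwa [integrableOn_iff_integrable_of_support_subset] at hi
  intro q hq
  refine subset_tsupport Φ fun h0 => hq ?_
  simp [h0]

lemma integral_dirDeriv_mul {g Φ : Esp n × ℝ → ℝ} (e : Esp n × ℝ)
    (hg : ContDiffOn ℝ (⊤ : ℕ∞) g (past n)) (hΦ : ContDiff ℝ (⊤ : ℕ∞) Φ)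
    (hc : HasCompactSupport Φ) (hs : tsupport Φ ⊆ past n) :
    ∫ q, dirDeriv e g q * Φ q = - ∫ q, g q * dirDeriv e Φ q := by
  have ht : tsupport (dirDeriv e Φ) ⊆ tsupport Φ := tsupport_fderiv_apply_subset ℝ e
  simp only [dirDeriv]
  rw [integral_mul_fderiv_eq_neg_fderiv_mul_of_integrable (f := g) (g := Φ) (v := e), neg_neg]
  · exact integrable_mul_of_tsupport (contDiffOn_dirDeriv e hg).continuousOn hΦ.continuous hc hs
  · exact integrable_mul_of_tsupport hg.continuousOn (contDiff_dirDeriv e hΦ).continuous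
      (hc.mono' (subset_tsupport _ |>.trans ht)) (ht.trans hs)
  · exact integrable_mul_of_tsupport hg.continuousOn hΦ.continuous hc hs
  · exact fun q hq => differentiableAt_of_mem hg (hs hq)
  · exact fun q _ => (hΦ.differentiable (by simp)).differentiableAt

lemma tsupport_dirDeriv_subset (e : Esp n × ℝ) (Φ : Esp n × ℝ → ℝ) :
    tsupport (dirDeriv e Φ) ⊆ tsupport Φ := tsupport_fderiv_apply_subset ℝ e

lemma hasCompactSupport_dirDeriv (e : Esp n × ℝ) {Φ : Esp n × ℝ → ℝ} (hc : HasCompactSupport Φ) :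
    HasCompactSupport (dirDeriv e Φ) :=
  hc.mono' ((subset_tsupport _).trans (tsupport_dirDeriv_subset e Φ))

lemma dirDeriv_mul {a b : Esp n × ℝ → ℝ} (e : Esp n × ℝ) {q : Esp n × ℝ}
    (ha : DifferentiableAt ℝ a q) (hb : DifferentiableAt ℝ b q) :
    dirDeriv e (fun q => a q * b q) q = dirDeriv e a q * b q + a q * dirDeriv e b q := by
  simp only [dirDeriv]
  rw [fderiv_fun_mul ha hb]
  simp
  ring

lemma dirDeriv_comp {f : ℝ → ℝ} {v : Esp n × ℝ → ℝ} (e : Esp n × ℝ) {q : Esp n × ℝ}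
    (hf : DifferentiableAt ℝ f (v q)) (hv : DifferentiableAt ℝ v q) :
    dirDeriv e (fun q => f (v q)) q = deriv f (v q) * dirDeriv e v q := by
  have h := (hf.hasDerivAt.comp_hasFDerivAt q hv.hasFDerivAt).fderiv
  change fderiv ℝ (f ∘ v) q e = _
  rw [h]
  simp [dirDeriv]

lemma contDiff_deriv {f : ℝ → ℝ} (hf : ContDiff ℝ (⊤ : ℕ∞) f) :
    ContDiff ℝ (⊤ : ℕ∞) (deriv f) :=
  (contDiff_infty_iff_deriv.1 hf).2

lemma dirDeriv_dirDeriv_comp {f : ℝ → ℝ} {v : Esp n × ℝ → ℝ} (e : Esp n × ℝ)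
    (hf : ContDiff ℝ (⊤ : ℕ∞) f) (hv : ContDiffOn ℝ (⊤ : ℕ∞) v (past n))
    {q : Esp n × ℝ} (hq : q ∈ past n) :
    dirDeriv e (dirDeriv e (fun q => f (v q))) q =
      deriv (deriv f) (v q) * dirDeriv e v q ^ 2 +
        deriv f (v q) * dirDeriv e (dirDeriv e v) q := by
  have h1 : EqOn (dirDeriv e (fun q => f (v q))) (fun q => deriv f (v q) * dirDeriv e v q)
      (past n) := fun q hq =>
    dirDeriv_comp e (hf.differentiable (by simp) _) (differentiableAt_of_mem hv hq)
  have hf' := (contDiff_deriv hf).differentiable (by simp)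
  have hvq := differentiableAt_of_mem hv hq
  rw [dirDeriv_congr e h1 hq, dirDeriv_mul (a := fun q => deriv f (v q)) e ((hf' _).comp q hvq)
    (differentiableAt_of_mem (contDiffOn_dirDeriv e hv) hq), dirDeriv_comp e (hf' _) hvq]
  ring

/-- The energy identity for a nonlinear function of a caloric function, in weak form. -/
lemma IsCaloric.energy_identity {v Φ : Esp n × ℝ → ℝ} {f : ℝ → ℝ} (hv : IsCaloric v)
    (hf : ContDiff ℝ (⊤ : ℕ∞) f) (hΦ : ContDiff ℝ (⊤ : ℕ∞) Φ)
    (hc : HasCompactSupport Φ) (hs : tsupport Φ ⊆ past n) :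
    ∫ q, deriv (deriv f) (v q) * (∑ i, CaloricLiouville.dirDeriv (spaceDir i) v q ^ 2) * Φ q =
      ∫ q, f (v q) * (∑ i, CaloricLiouville.dirDeriv (spaceDir i)
        (CaloricLiouville.dirDeriv (spaceDir i) Φ) q +
          CaloricLiouville.dirDeriv (timeDir n) Φ q) := by
  set g : Esp n × ℝ → ℝ := fun q => f (v q) with hg_def
  have hg : ContDiffOn ℝ (⊤ : ℕ∞) g (past n) := hf.comp_contDiffOn hv.contDiffOn
  have h1 : ∀ q, deriv (deriv f) (v q) *
      (∑ i, CaloricLiouville.dirDeriv (spaceDir i) v q ^ 2) * Φ q =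
      ∑ i, CaloricLiouville.dirDeriv (spaceDir i) (CaloricLiouville.dirDeriv (spaceDir i) g) q
        * Φ q - CaloricLiouville.dirDeriv (timeDir n) g q * Φ q := by
    intro q
    by_cases hq : q ∈ past n
    · rw [← Finset.sum_mul, ← sub_mul]
      congr 1
      rw [hg_def, dirDeriv_comp _ (hf.differentiable (by simp) _)
        (differentiableAt_of_mem hv.contDiffOn hq), ← hv.heat q hq,
        Finset.sum_congr rfl fun i _ => dirDeriv_dirDeriv_comp (spaceDir i) hf hv.contDiffOn hq,
        Finset.sum_add_distrib, Finset.mul_sum, Finset.mul_sum]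
      ring
    · have : Φ q = 0 := by
        by_contra h
        exact hq (hs (subset_tsupport Φ h))
      simp [this]
  have hd := fun e => contDiff_dirDeriv e hΦ
  have hdc := fun e => hasCompactSupport_dirDeriv e hc
  have hds := fun e => (tsupport_dirDeriv_subset e Φ).trans hs
  have hdd := fun e => contDiff_dirDeriv e (hd e)
  have hddc := fun e => hasCompactSupport_dirDeriv e (hdc e)
  have hdds := fun e => (tsupport_dirDeriv_subset e _).trans (hds e)
  have hgg := fun e => contDiffOn_dirDeriv e (contDiffOn_dirDeriv e hg)
  simp_rw [h1, mul_add, Finset.mul_sum]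
  rw [integral_sub, integral_add, integral_finsetSum, integral_finsetSum,
    integral_dirDeriv_mul _ hg hΦ hc hs, sub_neg_eq_add]
  · congr 1
    refine Finset.sum_congr rfl fun i _ => ?_
    rw [integral_dirDeriv_mul _ (contDiffOn_dirDeriv _ hg) hΦ hc hs,
      integral_dirDeriv_mul _ hg (hd _) (hdc _) (hds _), neg_neg]
  · exact fun i _ => integrable_mul_of_tsupport hg.continuousOn (hdd _).continuous (hddc _)
      (hdds _)
  · exact fun i _ => integrable_mul_of_tsupport (hgg _).continuousOn hΦ.continuous hc hs
  · exact integrable_finsetSum _ fun i _ => integrable_mul_of_tsupport hg.continuousOn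
      (hdd _).continuous (hddc _) (hdds _)
  · exact integrable_mul_of_tsupport hg.continuousOn (hd _).continuous (hdc _) (hds _)
  · exact integrable_finsetSum _ fun i _ => integrable_mul_of_tsupport (hgg _).continuousOn
      hΦ.continuous hc hs
  · exact integrable_mul_of_tsupport (contDiffOn_dirDeriv _ hg).continuousOn hΦ.continuous hc hs

/-- The closed backward cylinder of radius `R`, truncated at time `-δ`. -/
def cyl (n : ℕ) (R δ : ℝ) : Set (Esp n × ℝ) :=
  Metric.closedBall 0 R ×ˢ Icc (-(R ^ 2)) (-δ)

lemma isCompact_cyl (R δ : ℝ) : IsCompact (cyl n R δ) :=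
  (isCompact_closedBall _ _).prod isCompact_Icc

lemma measurableSet_cyl (R δ : ℝ) : MeasurableSet (cyl n R δ) :=
  (isCompact_cyl R δ).isClosed.measurableSet

lemma cyl_subset_past {R δ : ℝ} (hδ : 0 < δ) : cyl n R δ ⊆ past n := fun q hq => by
  have := hq.2.2
  simp only [past, mem_ofPred_eq]
  linarith

lemma cyl_subset_cyl {R R' δ δ' : ℝ} (hR : 0 ≤ R) (hRR' : R ≤ R') (hδ : δ' ≤ δ) :
    cyl n R δ ⊆ cyl n R' δ' := by
  refine prod_mono (Metric.closedBall_subset_closedBall hRR') (Icc_subset_Icc ?_ (by linarith))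
  have := pow_le_pow_left₀ hR hRR' 2
  linarith

lemma exists_bound_deriv_smoothTransition :
    ∃ B, ∀ t, |deriv Real.smoothTransition t| ≤ B := by
  have hc : Continuous (deriv Real.smoothTransition) :=
    (contDiff_deriv (Real.smoothTransition.contDiff (n := (⊤ : ℕ∞)))).continuous
  have hs : HasCompactSupport (deriv Real.smoothTransition) := by
    refine HasCompactSupport.intro (isCompact_Icc (a := (0 : ℝ)) (b := 1)) fun t ht => ?_
    rcases lt_or_ge t 0 with h | h
    · have : Real.smoothTransition =ᶠ[nhds t] fun _ => 0 := by
        filter_upwards [Iio_mem_nhds h] with s hs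
        exact Real.smoothTransition.zero_of_nonpos (le_of_lt hs)
      rw [this.deriv_eq, deriv_const]
    · have h1 : 1 < t := by
        by_contra h1
        exact ht ⟨h, not_lt.1 h1⟩
      have : Real.smoothTransition =ᶠ[nhds t] fun _ => 1 := by
        filter_upwards [Ioi_mem_nhds h1] with s hs
        exact Real.smoothTransition.one_of_one_le (le_of_lt hs)
      rw [this.deriv_eq, deriv_const]
  exact hc.bounded_above_of_compact_support hs

lemma dirDeriv_separated {a : Esp n → ℝ} {T : ℝ → ℝ} (ha : Differentiable ℝ a)
    (hT : Differentiable ℝ T) (c : ℝ) (e q : Esp n × ℝ) :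
    dirDeriv e (fun q => a (c • q.1) * T q.2) q =
      c * fderiv ℝ a (c • q.1) e.1 * T q.2 + a (c • q.1) * (e.2 * deriv T q.2) := by
  have h1 : HasFDerivAt (fun q : Esp n × ℝ => c • q.1)
      (c • ContinuousLinearMap.fst ℝ (Esp n) ℝ) q := hasFDerivAt_fst.const_smul c
  have h2 : HasFDerivAt (fun q : Esp n × ℝ => a (c • q.1)) _ q :=
    (ha (c • q.1)).hasFDerivAt.comp q h1
  have h3 : HasFDerivAt (fun q : Esp n × ℝ => T q.2) _ q :=
    (hT q.2).hasFDerivAt.comp q hasFDerivAt_snd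
  have h4 : HasFDerivAt (fun q : Esp n × ℝ => a (c • q.1) * T q.2) _ q := h2.mul h3
  simp only [dirDeriv]
  rw [h4.fderiv]
  simp
  ring

lemma dirDeriv_spaceDir_separated {a : Esp n → ℝ} {T : ℝ → ℝ} (ha : Differentiable ℝ a)
    (hT : Differentiable ℝ T) (c : ℝ) (i : Fin n) :
    dirDeriv (spaceDir i) (fun q => a (c • q.1) * T q.2) =
      fun q => fderiv ℝ a (c • q.1) (EuclideanSpace.single i 1) * (c * T q.2) := by
  funext q
  rw [dirDeriv_separated ha hT]
  simp [spaceDir]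
  ring

lemma dirDeriv_timeDir_separated {a : Esp n → ℝ} {T : ℝ → ℝ} (ha : Differentiable ℝ a)
    (hT : Differentiable ℝ T) (c : ℝ) (q : Esp n × ℝ) :
    dirDeriv (timeDir n) (fun q => a (c • q.1) * T q.2) q = a (c • q.1) * deriv T q.2 := by
  rw [dirDeriv_separated ha hT]
  simp [timeDir]

lemma exists_bound_second_deriv {a : Esp n → ℝ} (ha : ContDiff ℝ (⊤ : ℕ∞) a)
    (hc : HasCompactSupport a) (e : Esp n) :
    ∃ B, ∀ x, |fderiv ℝ (fun y => fderiv ℝ a y e) x e| ≤ B := by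
  have h1 : ContDiff ℝ (⊤ : ℕ∞) (fun y => fderiv ℝ a y e) :=
    (ha.fderiv_right (by simp)).clm_apply contDiff_const
  have h2 : ContDiff ℝ (⊤ : ℕ∞) (fun x => fderiv ℝ (fun y => fderiv ℝ a y e) x e) :=
    (h1.fderiv_right (by simp)).clm_apply contDiff_const
  exact h2.continuous.bounded_above_of_compact_support
    ((hc.fderiv_apply (𝕜 := ℝ) e).fderiv_apply (𝕜 := ℝ) e)

/-- Parabolic cutoff functions, with scale-invariant one-sided bounds on the adjoint heat
operator. -/
lemma exists_cutoff (n : ℕ) : ∃ A, 0 ≤ A ∧ ∀ R δ : ℝ, 0 < R → 0 < δ →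
    ∃ Φ : Esp n × ℝ → ℝ, ContDiff ℝ (⊤ : ℕ∞) Φ ∧ tsupport Φ ⊆ cyl n (2 * R) δ ∧
      (∀ q, 0 ≤ Φ q) ∧ (∀ q ∈ cyl n R (2 * δ), Φ q = 1) ∧
      ∀ q, ∑ i, dirDeriv (spaceDir i) (dirDeriv (spaceDir i) Φ) q + dirDeriv (timeDir n) Φ q
        ≤ A / R ^ 2 := by
  let χ : ContDiffBump (0 : Esp n) := ⟨1, 2, by norm_num, by norm_num⟩
  have hχ : ContDiff ℝ (⊤ : ℕ∞) (χ : Esp n → ℝ) := χ.contDiff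
  have hχd : Differentiable ℝ (χ : Esp n → ℝ) := hχ.differentiable (by simp)
  choose B hB using fun i : Fin n =>
    exists_bound_second_deriv hχ χ.hasCompactSupport (EuclideanSpace.single i 1)
  obtain ⟨B', hB'⟩ := exists_bound_deriv_smoothTransition
  have hB0 : ∀ i, 0 ≤ B i := fun i => (abs_nonneg _).trans (hB i 0)
  have hB'0 : 0 ≤ B' := (abs_nonneg _).trans (hB' 0)
  refine ⟨∑ i, B i + B', add_nonneg (Finset.sum_nonneg fun i _ => hB0 i) hB'0,
    fun R δ hR hδ => ?_⟩
  set S := Real.smoothTransition with hS_def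
  have hS : ContDiff ℝ (⊤ : ℕ∞) S := Real.smoothTransition.contDiff
  have hSd : Differentiable ℝ S := hS.differentiable (by simp)
  set T : ℝ → ℝ := fun t => S (t / R ^ 2 + 2) * S (-t / δ - 1) with hT_def
  have hT : ContDiff ℝ (⊤ : ℕ∞) T := by
    refine (hS.comp ?_).mul (hS.comp ?_) <;> fun_prop
  have hTd : Differentiable ℝ T := hT.differentiable (by simp)
  have hT0 : ∀ t, 0 ≤ T t := fun t =>
    mul_nonneg (Real.smoothTransition.nonneg _) (Real.smoothTransition.nonneg _)
  have hT1 : ∀ t, T t ≤ 1 := fun t => mul_le_one₀ (Real.smoothTransition.le_one _)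
    (Real.smoothTransition.nonneg _) (Real.smoothTransition.le_one _)
  have hT' : ∀ t, deriv T t ≤ B' / R ^ 2 := by
    intro t
    have h1 : HasDerivAt (fun t : ℝ => t / R ^ 2 + 2) (1 / R ^ 2) t :=
      ((hasDerivAt_id t).div_const _).add_const _
    have h2 : HasDerivAt (fun t : ℝ => -t / δ - 1) (-1 / δ) t :=
      ((hasDerivAt_id t).neg.div_const _).sub_const _
    have h3 : HasDerivAt T _ t := ((hSd _).hasDerivAt.comp t h1).mul
      ((hSd _).hasDerivAt.comp t h2)
    rw [h3.deriv]
    have hpos : ∀ s, 0 ≤ deriv S s := fun s => Real.smoothTransition.monotone.deriv_nonneg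
    have h4 : deriv S (t / R ^ 2 + 2) * (1 / R ^ 2) * S (-t / δ - 1) ≤ B' * (1 / R ^ 2) * 1 := by
      gcongr
      · exact Real.smoothTransition.nonneg _
      · exact (le_abs_self _).trans (hB' _)
      · exact Real.smoothTransition.le_one _
    have h5 : 0 ≤ S (t / R ^ 2 + 2) * (deriv S (-t / δ - 1) * (1 / δ)) :=
      mul_nonneg (Real.smoothTransition.nonneg _) (mul_nonneg (hpos _) (by positivity))
    have h6 : -1 / δ = -(1 / δ) := by ring
    simp only [Function.comp_def, h6]
    have h7 : B' / R ^ 2 = B' * (1 / R ^ 2) * 1 := by ring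
    rw [h7]
    linarith
  refine ⟨fun q => χ (R⁻¹ • q.1) * T q.2, ?_, ?_, ?_, ?_, ?_⟩
  · refine (hχ.comp ?_).mul (hT.comp ?_) <;> fun_prop
  · refine closure_minimal ?_ (isCompact_cyl _ _).isClosed
    intro q hq
    have hq1 : χ (R⁻¹ • q.1) ≠ 0 := left_ne_zero_of_mul hq
    have hq2 : T q.2 ≠ 0 := right_ne_zero_of_mul hq
    have hx : R⁻¹ • q.1 ∈ Function.support χ := hq1
    rw [χ.support_eq, mem_ball_zero_iff, norm_smul, norm_inv, Real.norm_of_nonneg hR.le] at hx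
    have hx' : ‖q.1‖ < 2 * R := by
      have := (inv_mul_lt_iff₀ hR).1 hx
      simpa [χ, mul_comm] using this
    have ht1 : 0 < q.2 / R ^ 2 + 2 := by
      by_contra h
      exact hq2 (by simp [hT_def, hS_def, Real.smoothTransition.zero_of_nonpos (not_lt.1 h)])
    have ht2 : 0 < -q.2 / δ - 1 := by
      by_contra h
      exact hq2 (by simp [hT_def, hS_def, Real.smoothTransition.zero_of_nonpos (not_lt.1 h)])
    have ht3 : -2 < q.2 / R ^ 2 := by linarith
    rw [lt_div_iff₀ (by positivity)] at ht3
    have ht4 : 1 < -q.2 / δ := by linarith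
    rw [lt_div_iff₀ hδ] at ht4
    refine ⟨mem_closedBall_zero_iff.2 hx'.le, ?_, by linarith⟩
    nlinarith [sq_nonneg R]
  · exact fun q => mul_nonneg χ.nonneg (hT0 _)
  · intro q hq
    have hx : χ (R⁻¹ • q.1) = 1 := by
      apply χ.one_of_mem_closedBall
      have := mem_closedBall_zero_iff.1 hq.1
      rw [mem_closedBall_zero_iff, norm_smul, norm_inv, Real.norm_of_nonneg hR.le,
        inv_mul_le_iff₀ hR]
      simpa [χ] using this
    have h1 : 1 ≤ q.2 / R ^ 2 + 2 := by
      have := hq.2.1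
      have : -1 ≤ q.2 / R ^ 2 := by rw [le_div_iff₀ (by positivity)]; linarith
      linarith
    have h2 : 1 ≤ -q.2 / δ - 1 := by
      have := hq.2.2
      have : 2 ≤ -q.2 / δ := by rw [le_div_iff₀ hδ]; linarith
      linarith
    simp [hx, hT_def, hS_def, Real.smoothTransition.one_of_one_le h1,
      Real.smoothTransition.one_of_one_le h2]
  · intro q
    have h1 : ∀ i, dirDeriv (spaceDir i) (dirDeriv (spaceDir i)
        (fun q : Esp n × ℝ => χ (R⁻¹ • q.1) * T q.2)) q ≤ B i / R ^ 2 := by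
      intro i
      have ha : Differentiable ℝ (fun y => fderiv ℝ χ y (EuclideanSpace.single i 1)) :=
        ((hχ.fderiv_right (m := (⊤ : ℕ∞)) (by simp)).clm_apply contDiff_const).differentiable
          (by simp)
      rw [dirDeriv_spaceDir_separated hχd hTd, dirDeriv_spaceDir_separated
        (a := fun y => fderiv ℝ χ y (EuclideanSpace.single i 1)) (T := fun t => R⁻¹ * T t) ha
        (hTd.const_mul _)]
      have h2 := (le_abs_self _).trans (hB i (R⁻¹ • q.1))
      calc _ ≤ B i * (R⁻¹ * (R⁻¹ * T q.2)) := by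
            have := hT0 q.2
            exact mul_le_mul_of_nonneg_right h2 (by positivity)
        _ ≤ B i * (R⁻¹ * (R⁻¹ * 1)) := by
            gcongr
            · exact hB0 i
            · exact hT1 _
        _ = B i / R ^ 2 := by field_simp
    have h2 : dirDeriv (timeDir n) (fun q : Esp n × ℝ => χ (R⁻¹ • q.1) * T q.2) q
        ≤ B' / R ^ 2 := by
      rw [dirDeriv_timeDir_separated hχd hTd]
      calc χ (R⁻¹ • q.1) * deriv T q.2 ≤ χ (R⁻¹ • q.1) * (B' / R ^ 2) := by
            gcongr
            · exact χ.nonneg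
            · exact hT' _
        _ ≤ 1 * (B' / R ^ 2) := by
            gcongr
            exact χ.le_one
        _ = _ := one_mul _
    rw [add_div, Finset.sum_div]
    exact add_le_add (Finset.sum_le_sum fun i _ => h1 i) h2

/-- The regularization `s ↦ (m + s²)^{p/2}` of `|s|^p`. -/
def regPow (m p s : ℝ) : ℝ := (m + s ^ 2) ^ (p / 2)

section regPow

variable {m p : ℝ}

lemma contDiff_regPow (hm : 0 < m) : ContDiff ℝ (⊤ : ℕ∞) (regPow m p) := by
  refine ContDiff.rpow_const_of_ne (by fun_prop) fun s => ?_
  positivity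

lemma regPow_nonneg (hm : 0 < m) (s : ℝ) : 0 ≤ regPow m p s := by
  unfold regPow
  positivity

lemma hasDerivAt_rpow_add_sq (hm : 0 < m) (r s : ℝ) :
    HasDerivAt (fun s : ℝ => (m + s ^ 2) ^ r) (2 * s * r * (m + s ^ 2) ^ (r - 1)) s := by
  have h : HasDerivAt (fun s : ℝ => m + s ^ 2) (2 * s) s := by
    simpa using (hasDerivAt_pow 2 s).const_add m
  exact h.rpow_const (Or.inl (by positivity))

lemma le_deriv_deriv_regPow (hm : 0 < m) (hp : 1 < p) (hp2 : p ≤ 2) (s : ℝ) :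
    p * (p - 1) * (m + s ^ 2) ^ (p / 2 - 1) ≤ deriv (deriv (regPow m p)) s := by
  have h1 : deriv (regPow m p) = fun s => p * s * (m + s ^ 2) ^ (p / 2 - 1) := by
    funext s
    change deriv (fun s : ℝ => (m + s ^ 2) ^ (p / 2)) s = _
    rw [(hasDerivAt_rpow_add_sq hm _ s).deriv]
    ring
  have h2 : HasDerivAt (fun s : ℝ => p * s * (m + s ^ 2) ^ (p / 2 - 1))
      (p * 1 * (m + s ^ 2) ^ (p / 2 - 1) +
        p * s * (2 * s * (p / 2 - 1) * (m + s ^ 2) ^ (p / 2 - 1 - 1))) s :=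
    ((hasDerivAt_id s).const_mul p).mul (hasDerivAt_rpow_add_sq hm _ s)
  have hpos : 0 < m + s ^ 2 := by positivity
  have h3 : (m + s ^ 2) ^ (p / 2 - 1) = (m + s ^ 2) * (m + s ^ 2) ^ (p / 2 - 1 - 1) := by
    rw [Real.rpow_sub_one hpos.ne' (p / 2 - 1)]
    field_simp
  rw [h1, h2.deriv, h3]
  have h4 : 0 ≤ (m + s ^ 2) ^ (p / 2 - 1 - 1) := by positivity
  have h5 : 0 ≤ p * (2 - p) * m * (m + s ^ 2) ^ (p / 2 - 1 - 1) := by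
    have : 0 ≤ 2 - p := by linarith
    positivity
  linarith [h5]

lemma regPow_le (hm : 0 < m) (hp : 0 ≤ p) (hp2 : p ≤ 2) (s : ℝ) :
    regPow m p s ≤ m ^ (p / 2) + |s| ^ p := by
  have h := NNReal.rpow_add_le_add_rpow (p := p / 2) ⟨m, hm.le⟩ ⟨s ^ 2, sq_nonneg s⟩
    (by linarith) (by linarith)
  have h' : (m + s ^ 2) ^ (p / 2) ≤ m ^ (p / 2) + (s ^ 2) ^ (p / 2) := by exact_mod_cast h
  have h2 : (s ^ 2) ^ (p / 2) = |s| ^ p := by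
    rw [← sq_abs, ← Real.rpow_natCast, ← Real.rpow_mul (abs_nonneg s)]
    congr 1
    push_cast
    ring
  rwa [h2] at h'

lemma abs_rpow_le_add_regPow (hm : 0 < m) (hp : 0 < p) (hp2 : p ≤ 2) {R : ℝ} (hR : 0 < R)
    (d s : ℝ) : |d| ^ p ≤
      R ^ (2 - p) * ((m + s ^ 2) ^ (p / 2 - 1) * d ^ 2) + R ^ (-p) * regPow m p s := by
  set z := m + s ^ 2 with hz
  have hzpos : 0 < z := by positivity
  set b := R⁻¹ * z ^ (1 / 2 : ℝ) with hb
  have hbpos : 0 < b := by positivity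
  have hbp : b ^ p = R ^ (-p) * regPow m p s := by
    rw [hb, Real.mul_rpow (by positivity) (by positivity), Real.inv_rpow hR.le, Real.rpow_neg hR.le,
      ← Real.rpow_mul hzpos.le, regPow, ← hz]
    ring_nf
  have hb2 : b ^ (p - 2) = R ^ (2 - p) * z ^ (p / 2 - 1) := by
    rw [hb, Real.mul_rpow (by positivity) (by positivity), Real.inv_rpow hR.le,
      ← Real.rpow_neg hR.le, ← Real.rpow_mul hzpos.le]
    ring_nf
  rw [← hbp, ← mul_assoc, ← hb2]
  rcases le_total |d| b with h | h
  · have h1 : |d| ^ p ≤ b ^ p := Real.rpow_le_rpow (abs_nonneg _) h hp.le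
    have h2 : 0 ≤ b ^ (p - 2) * d ^ 2 := by positivity
    linarith
  · have hd : 0 < |d| := hbpos.trans_le h
    have h1 : |d| ^ (p - 2) ≤ b ^ (p - 2) :=
      Real.rpow_le_rpow_of_nonpos hbpos h (by linarith)
    have h2 : |d| ^ p = |d| ^ (p - 2) * d ^ 2 := by
      rw [← sq_abs d, ← Real.rpow_natCast |d| 2, ← Real.rpow_add hd]
      norm_num
    rw [h2]
    have h3 : 0 ≤ b ^ p := by positivity
    have h4 := mul_le_mul_of_nonneg_right h1 (sq_nonneg d)
    linarith

end regPow

lemma integrableOn_cyl {h : Esp n × ℝ → ℝ} (hh : ContinuousOn h (past n)) {R δ : ℝ}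
    (hδ : 0 < δ) : IntegrableOn h (cyl n R δ) :=
  (hh.mono (cyl_subset_past hδ)).integrableOn_compact (isCompact_cyl R δ)

/-- The Caccioppoli inequality in `L^p`, for `1 < p ≤ 2`. -/
lemma exists_caccioppoli (n : ℕ) {p : ℝ} (hp : 1 < p) (hp2 : p ≤ 2) :
    ∃ A, 0 ≤ A ∧ ∀ (v : Esp n × ℝ → ℝ), IsCaloric v → ∀ (i : Fin n) (R δ : ℝ), 0 < R → 0 < δ →
      ∫ q in cyl n R (2 * δ), |dirDeriv (spaceDir i) v q| ^ p ≤
        A * R ^ (-p) * ∫ q in cyl n (2 * R) δ, |v q| ^ p := by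
  obtain ⟨A, hA, hcut⟩ := exists_cutoff n
  have hc0 : 0 < p * (p - 1) := mul_pos (by linarith) (by linarith)
  refine ⟨A / (p * (p - 1)) + 1, by positivity, fun v hv i R δ hR hδ => ?_⟩
  obtain ⟨Φ, hΦ, hΦs, hΦ0, hΦ1, hΦL⟩ := hcut R δ hR hδ
  have hs : tsupport Φ ⊆ past n := hΦs.trans (cyl_subset_past hδ)
  have hc : HasCompactSupport Φ :=
    HasCompactSupport.of_support_subset_isCompact (isCompact_cyl (2 * R) δ)
      ((subset_tsupport Φ).trans hΦs)
  have hvc := hv.contDiffOn.continuousOn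
  have hDc := fun j => (contDiffOn_dirDeriv (spaceDir j) hv.contDiffOn).continuousOn
  have hsub : cyl n R (2 * δ) ⊆ cyl n (2 * R) δ :=
    cyl_subset_cyl hR.le (by linarith) (by linarith)
  have h2δ : 0 < 2 * δ := by linarith
  set K := (A / (p * (p - 1)) + 1) * R ^ (-p) with hK
  have key : ∀ m : ℝ, 0 < m → ∫ q in cyl n R (2 * δ), |dirDeriv (spaceDir i) v q| ^ p ≤
      K * (m ^ (p / 2) * volume.real (cyl n (2 * R) δ) +
        ∫ q in cyl n (2 * R) δ, |v q| ^ p) := by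
    intro m hm
    have hf := contDiff_regPow (p := p) hm
    have hfc : ContinuousOn (fun q => regPow m p (v q)) (past n) :=
      hf.continuous.comp_continuousOn hvc
    have hwc : ContinuousOn (fun q => (m + v q ^ 2) ^ (p / 2 - 1) *
        dirDeriv (spaceDir i) v q ^ 2) (past n) := by
      refine ContinuousOn.mul (ContinuousOn.rpow_const (by fun_prop) fun q _ => Or.inl ?_)
        ((hDc i).pow 2)
      positivity
    have henergy := hv.energy_identity hf hΦ hc hs
    have hupper : ∫ q, regPow m p (v q) * (∑ i, dirDeriv (spaceDir i)
        (dirDeriv (spaceDir i) Φ) q + dirDeriv (timeDir n) Φ q) ≤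
        A / R ^ 2 * ∫ q in cyl n (2 * R) δ, regPow m p (v q) := by
      have hzero : ∀ q, q ∉ cyl n (2 * R) δ → regPow m p (v q) * (∑ i, dirDeriv (spaceDir i)
          (dirDeriv (spaceDir i) Φ) q + dirDeriv (timeDir n) Φ q) = 0 := by
        intro q hq
        have h1 : ∀ e, dirDeriv e Φ q = 0 := fun e => by
          by_contra h
          exact hq (hΦs (tsupport_dirDeriv_subset e Φ (subset_tsupport _ h)))
        have h2 : ∀ e, dirDeriv e (dirDeriv e Φ) q = 0 := fun e => by
          by_contra h
          exact hq (hΦs (tsupport_dirDeriv_subset e Φ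
            (tsupport_dirDeriv_subset e _ (subset_tsupport _ h))))
        simp [h1, h2]
      rw [← setIntegral_eq_integral_of_forall_compl_eq_zero hzero, ← integral_const_mul]
      have hLc : Continuous fun q => ∑ i, dirDeriv (spaceDir i) (dirDeriv (spaceDir i) Φ) q +
          dirDeriv (timeDir n) Φ q :=
        (continuous_finsetSum _ fun i _ =>
          (contDiff_dirDeriv _ (contDiff_dirDeriv _ hΦ)).continuous).add
          (contDiff_dirDeriv _ hΦ).continuous
      refine setIntegral_mono_on (integrableOn_cyl (hfc.mul hLc.continuousOn) hδ)
        ((integrableOn_cyl hfc hδ).const_mul _) (measurableSet_cyl _ _) fun q _ => ?_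
      rw [mul_comm (A / R ^ 2)]
      exact mul_le_mul_of_nonneg_left (hΦL q) (regPow_nonneg hm _)
    have hsecond : ∀ s, 0 ≤ deriv (deriv (regPow m p)) s := fun s =>
      le_trans (by positivity) (le_deriv_deriv_regPow hm hp hp2 s)
    have hlower : p * (p - 1) * ∫ q in cyl n R (2 * δ), (m + v q ^ 2) ^ (p / 2 - 1) *
        dirDeriv (spaceDir i) v q ^ 2 ≤
        ∫ q, deriv (deriv (regPow m p)) (v q) *
          (∑ i, dirDeriv (spaceDir i) v q ^ 2) * Φ q := by
      have hsc : ContinuousOn (fun q => deriv (deriv (regPow m p)) (v q) *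
          (∑ i, dirDeriv (spaceDir i) v q ^ 2)) (past n) :=
        ((contDiff_deriv (contDiff_deriv hf)).continuous.comp_continuousOn hvc).mul
          (continuousOn_finsetSum _ fun j _ => (hDc j).pow 2)
      have hint := integrable_mul_of_tsupport hsc hΦ.continuous hc hs
      refine le_trans ?_ (setIntegral_le_integral (s := cyl n R (2 * δ)) hint
        (Eventually.of_forall fun q => ?_))
      · rw [← integral_const_mul]
        refine setIntegral_mono_on ((integrableOn_cyl hwc h2δ).const_mul _) hint.integrableOn
          (measurableSet_cyl _ _) fun q hq => ?_
        rw [hΦ1 q hq, mul_one, ← mul_assoc]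
        exact mul_le_mul (le_deriv_deriv_regPow hm hp hp2 _)
          (Finset.single_le_sum (f := fun j => dirDeriv (spaceDir j) v q ^ 2)
            (fun j _ => sq_nonneg _) (Finset.mem_univ i)) (sq_nonneg _) (hsecond _)
      · exact mul_nonneg (mul_nonneg (hsecond _) (Finset.sum_nonneg fun j _ => sq_nonneg _))
          (hΦ0 q)
    set I := ∫ q in cyl n (2 * R) δ, regPow m p (v q) with hI
    have hw : ∫ q in cyl n R (2 * δ), (m + v q ^ 2) ^ (p / 2 - 1) *
        dirDeriv (spaceDir i) v q ^ 2 ≤ A / R ^ 2 * I / (p * (p - 1)) := by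
      rw [le_div_iff₀ hc0, mul_comm]
      linarith
    have hIR : ∫ q in cyl n R (2 * δ), regPow m p (v q) ≤ I :=
      setIntegral_mono_set (integrableOn_cyl hfc hδ)
        (Eventually.of_forall fun q => regPow_nonneg hm _) hsub.eventuallyLE
    have hRp : R ^ (2 - p) = R ^ 2 * R ^ (-p) := by
      rw [← Real.rpow_natCast R 2, ← Real.rpow_add hR]
      norm_num [sub_eq_add_neg]
    have hRpos : 0 < R ^ (-p) := by positivity
    have hDpc : ContinuousOn (fun q => |dirDeriv (spaceDir i) v q| ^ p) (past n) :=
      (hDc i).abs.rpow_const fun q _ => Or.inr (by linarith)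
    have hvpc : ContinuousOn (fun q => |v q| ^ p) (past n) :=
      hvc.abs.rpow_const fun q _ => Or.inr (by linarith)
    have hIle : I ≤ m ^ (p / 2) * volume.real (cyl n (2 * R) δ) +
        ∫ q in cyl n (2 * R) δ, |v q| ^ p := by
      have : m ^ (p / 2) * volume.real (cyl n (2 * R) δ) =
          ∫ q in cyl n (2 * R) δ, m ^ (p / 2) := by
        rw [setIntegral_const, smul_eq_mul, mul_comm]
      rw [this, ← integral_add (integrableOn_cyl continuousOn_const hδ) (integrableOn_cyl hvpc hδ)]
      exact setIntegral_mono_on (integrableOn_cyl hfc hδ) (integrableOn_cyl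
        (continuousOn_const.add hvpc) hδ) (measurableSet_cyl _ _)
        fun q _ => regPow_le hm (by linarith) hp2 _
    calc ∫ q in cyl n R (2 * δ), |dirDeriv (spaceDir i) v q| ^ p
        ≤ ∫ q in cyl n R (2 * δ), (R ^ (2 - p) * ((m + v q ^ 2) ^ (p / 2 - 1) *
            dirDeriv (spaceDir i) v q ^ 2) + R ^ (-p) * regPow m p (v q)) :=
          setIntegral_mono_on (integrableOn_cyl hDpc h2δ) (integrableOn_cyl
            ((hwc.const_smul (R ^ (2 - p))).add (hfc.const_smul (R ^ (-p)))) h2δ)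
            (measurableSet_cyl _ _)
            fun q _ => abs_rpow_le_add_regPow hm (by linarith) hp2 hR _ _
      _ = R ^ (2 - p) * (∫ q in cyl n R (2 * δ), (m + v q ^ 2) ^ (p / 2 - 1) *
            dirDeriv (spaceDir i) v q ^ 2) +
            R ^ (-p) * ∫ q in cyl n R (2 * δ), regPow m p (v q) := by
          rw [integral_add ((integrableOn_cyl hwc h2δ).const_mul _)
            ((integrableOn_cyl hfc h2δ).const_mul _), integral_const_mul, integral_const_mul]
      _ ≤ R ^ (2 - p) * (A / R ^ 2 * I / (p * (p - 1))) + R ^ (-p) * I := by gcongr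
      _ = K * I := by
          rw [hRp, hK]
          field_simp
      _ ≤ _ := by gcongr
  have hlim : Tendsto (fun m : ℝ => K * (m ^ (p / 2) * volume.real (cyl n (2 * R) δ) +
      ∫ q in cyl n (2 * R) δ, |v q| ^ p)) (nhdsWithin 0 (Ioi 0))
      (nhds (K * ((0 : ℝ) ^ (p / 2) * volume.real (cyl n (2 * R) δ) +
        ∫ q in cyl n (2 * R) δ, |v q| ^ p))) := by
    refine Tendsto.mono_left ?_ nhdsWithin_le_nhds
    refine (((Real.continuousAt_rpow_const 0 (p / 2) (Or.inr ?_)).tendsto.mul_const _).add_const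
      _).const_mul _
    linarith
  have h := ge_of_tendsto hlim (eventually_nhdsWithin_of_forall key)
  rw [Real.zero_rpow (by linarith)] at h
  simpa using h

/-- The `L^p` averages of `v` over backward parabolic cylinders of size `R`, kept away from
time zero, grow at most like `R^κ`, uniformly in the distance to time zero. -/
def GrowsAtMost (p κ : ℝ) (v : Esp n × ℝ → ℝ) : Prop :=
  ∃ A, ∀ R δ : ℝ, 1 ≤ R → 0 < δ →
    ∫ q in cyl n R δ, |v q| ^ p ≤ A * R ^ ((n : ℝ) + 2 + κ * p)

section GrowsAtMost

variable {p κ : ℝ} {v : Esp n × ℝ → ℝ}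

lemma GrowsAtMost.dirDeriv (hp : 1 < p) (hp2 : p ≤ 2) (hv : IsCaloric v)
    (hg : GrowsAtMost p κ v) (i : Fin n) :
    GrowsAtMost p (κ - 1) (dirDeriv (spaceDir i) v) := by
  obtain ⟨B, hB, hcacc⟩ := exists_caccioppoli n hp hp2
  obtain ⟨A, hA⟩ := hg
  refine ⟨B * (A * 2 ^ ((n : ℝ) + 2 + κ * p)), fun R δ hR hδ => ?_⟩
  have hR0 : 0 < R := by linarith
  have h1 := hcacc v hv i R (δ / 2) hR0 (by positivity)
  rw [mul_div_cancel₀ δ two_ne_zero] at h1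
  refine h1.trans ?_
  calc B * R ^ (-p) * ∫ q in cyl n (2 * R) (δ / 2), |v q| ^ p
      ≤ B * R ^ (-p) * (A * (2 * R) ^ ((n : ℝ) + 2 + κ * p)) := by
        gcongr
        exact hA (2 * R) (δ / 2) (by linarith) (by positivity)
    _ = B * (A * 2 ^ ((n : ℝ) + 2 + κ * p)) * R ^ ((n : ℝ) + 2 + (κ - 1) * p) := by
        rw [Real.mul_rpow zero_le_two hR0.le,
          show (n : ℝ) + 2 + (κ - 1) * p = -p + ((n : ℝ) + 2 + κ * p) by ring,
          Real.rpow_add hR0 (-p)]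
        ring

/-- A bound by a negative power of arbitrarily large radii forces nonpositivity. -/
lemma nonpos_of_le_mul_rpow {a A b R₀ : ℝ} (hb : b < 0) (h : ∀ R, R₀ ≤ R → a ≤ A * R ^ b) :
    a ≤ 0 := by
  have hlim : Tendsto (fun R : ℝ => A * R ^ b) atTop (nhds (A * 0)) := by
    simpa using (tendsto_rpow_neg_atTop (neg_pos.2 hb)).const_mul A
  rw [mul_zero] at hlim
  exact ge_of_tendsto hlim (eventually_ge_atTop R₀ |>.mono h)

lemma GrowsAtMost.eq_zero_of_neg (hp : 0 < p) (hv : ContinuousOn v (past n))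
    (hg : GrowsAtMost p κ v) (hκ : (n : ℝ) + 2 + κ * p < 0) : ∀ q ∈ past n, v q = 0 := by
  obtain ⟨A, hA⟩ := hg
  intro q hq
  have hq' : q.2 < 0 := hq
  set δ := -q.2 / 2 with hδ
  have hδ0 : 0 < δ := by simp only [hδ]; linarith
  set R₀ := ‖q.1‖ + 1 - q.2 with hR₀
  have hn := norm_nonneg q.1
  have hR1 : 1 ≤ R₀ := by simp only [hR₀]; linarith
  have hqR : -(R₀ ^ 2) < q.2 := by
    have : -q.2 < R₀ := by simp only [hR₀]; linarith
    nlinarith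
  have hvp : ContinuousOn (fun q => |v q| ^ p) (past n) :=
    hv.abs.rpow_const fun q _ => Or.inr hp.le
  have hpos : ∀ q, 0 ≤ |v q| ^ p := fun q => by positivity
  have hint : ∫ q in cyl n R₀ δ, |v q| ^ p = 0 := by
    refine le_antisymm (nonpos_of_le_mul_rpow (R₀ := R₀) hκ fun R hR => le_trans ?_
      (hA R δ (hR1.trans hR) hδ0)) (integral_nonneg hpos)
    exact setIntegral_mono_set (integrableOn_cyl hvp hδ0) (Eventually.of_forall hpos)
      (cyl_subset_cyl (by linarith) hR le_rfl).eventuallyLE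
  rw [setIntegral_eq_zero_iff_of_nonneg_ae (Eventually.of_forall hpos)
    (integrableOn_cyl hvp hδ0)] at hint
  set U : Set (Esp n × ℝ) := Metric.ball 0 R₀ ×ˢ Ioo (-(R₀ ^ 2)) (-δ) with hU
  have hUc : U ⊆ cyl n R₀ δ := prod_mono Metric.ball_subset_closedBall Ioo_subset_Icc_self
  have hzero : EqOn (fun q => |v q| ^ p) (fun _ => 0) U :=
    Measure.eqOn_open_of_ae_eq (ae_restrict_of_ae_restrict_of_subset hUc hint)
      (Metric.isOpen_ball.prod isOpen_Ioo) (hvp.mono (hUc.trans (cyl_subset_past hδ0)))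
      continuousOn_const
  have hqU : q ∈ U := by
    refine ⟨?_, hqR, ?_⟩
    · simp only [Metric.mem_ball, dist_zero_right, hR₀]; linarith
    · simp only [hδ]; linarith
  have := hzero hqU
  simpa [Real.rpow_eq_zero (abs_nonneg (v q)) hp.ne'] using this

lemma GrowsAtMost.eq_zero_of_const (hp : 0 < p) (hκ : κ < 0) (hg : GrowsAtMost p κ v) {c : ℝ}
    (hc : ∀ q ∈ past n, v q = c) : c = 0 := by
  obtain ⟨A, hA⟩ := hg
  set V := volume.real (Metric.ball (0 : Esp n) 1) with hV
  have hV0 : 0 < V := ENNReal.toReal_pos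
    (Metric.measure_ball_pos volume _ one_pos).ne' measure_ball_lt_top.ne
  have hle : |c| ^ p * (V / 2) ≤ 0 := by
    refine nonpos_of_le_mul_rpow (A := A) (b := κ * p) (R₀ := 1)
      (mul_neg_of_neg_of_pos hκ hp) fun R hR => ?_
    have hR0 : 0 < R := by linarith
    have hvol : volume.real (cyl n R (1 / 2)) = R ^ n * V * (R ^ 2 - 1 / 2) := by
      rw [cyl, Measure.volume_eq_prod, measureReal_prod_prod,
        Measure.addHaar_real_closedBall _ _ hR0.le, Real.volume_real_Icc_of_le (by nlinarith)]
      simp only [finrank_euclideanSpace, Fintype.card_fin, hV]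
      ring
    have h := hA R (1 / 2) hR (by norm_num)
    rw [setIntegral_congr_fun (g := fun _ => |c| ^ p) (measurableSet_cyl _ _)
      (fun q hq => by simp only [hc q (cyl_subset_past (by norm_num) hq)]),
      setIntegral_const, smul_eq_mul, hvol,
      Real.rpow_add hR0, Real.rpow_add hR0, Real.rpow_natCast, Real.rpow_two] at h
    have hpow : 0 < R ^ n * R ^ 2 := by positivity
    refine le_of_mul_le_mul_left ?_ hpow
    have : 0 ≤ |c| ^ p * V * R ^ n * (R ^ 2 / 2 - 1 / 2) :=
      mul_nonneg (by positivity) (by nlinarith)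
    linarith
  have h0 : |c| ^ p = 0 := by
    refine le_antisymm ?_ (by positivity)
    by_contra! h
    exact absurd hle (not_le.2 (by positivity))
  simpa [Real.rpow_eq_zero (abs_nonneg c) hp.ne'] using h0

lemma eq_zero_of_growsAtMost_of_nat (hp : 1 < p) (hp2 : p ≤ 2) (m : ℕ) :
    ∀ {κ : ℝ} {v : Esp n × ℝ → ℝ}, IsCaloric v → GrowsAtMost p κ v → κ < 0 →
      (n : ℝ) + 2 + (κ - m) * p < 0 → ∀ q ∈ past n, v q = 0 := by
  induction m with
  | zero =>
    intro κ v hv hg _ hm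
    exact hg.eq_zero_of_neg (by linarith) hv.contDiffOn.continuousOn (by simpa using hm)
  | succ m ih =>
    intro κ v hv hg hκ hm
    obtain ⟨c, hc⟩ := hv.exists_eq_const fun i =>
      ih (hv.dirDeriv (spaceDir i)) (hg.dirDeriv hp hp2 hv i) (by linarith)
        (by push_cast at hm; convert hm using 3; ring)
    intro q hq
    rw [hc q hq, hg.eq_zero_of_const (by linarith) hκ hc]

/-- Liouville: a caloric function on the past half-space of negative growth vanishes. -/
lemma IsCaloric.eq_zero_of_growsAtMost (hp : 1 < p) (hp2 : p ≤ 2) (hv : IsCaloric v)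
    (hg : GrowsAtMost p κ v) (hκ : κ < 0) : ∀ q ∈ past n, v q = 0 := by
  obtain ⟨m, hm⟩ := exists_nat_gt ((n : ℝ) + 2)
  refine eq_zero_of_growsAtMost_of_nat hp hp2 m hv hg hκ ?_
  have hm0 : 0 ≤ (m : ℝ) := m.cast_nonneg
  nlinarith

end GrowsAtMost

lemma measurableSet_Qneg (s : ℝ) : MeasurableSet (Qneg n s) := by
  have : Qneg n s = Metric.ball 0 s ×ˢ Ioc (-(s ^ 2)) 0 := by
    ext q; simp [Qneg]
  rw [this]
  exact measurableSet_ball.prod measurableSet_Ioc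

lemma Qneg_subset (s : ℝ) :
    Qneg n s ⊆ Metric.closedBall 0 s ×ˢ Icc (-(s ^ 2)) 0 := fun q hq =>
  ⟨by simpa using hq.1.le, hq.2.1.le, hq.2.2⟩

lemma volume_real_Qneg {s : ℝ} (hs : 0 < s) :
    volume.real (Qneg n s) = s ^ ((n : ℝ) + 2) * volume.real (Metric.ball (0 : Esp n) 1) := by
  have : Qneg n s = Metric.ball 0 s ×ˢ Ioc (-(s ^ 2)) 0 := by
    ext q; simp [Qneg]
  have hball : volume.real (Metric.ball (0 : Esp n) s) =
      s ^ n * volume.real (Metric.ball (0 : Esp n) 1) := by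
    rw [measureReal_def, Measure.addHaar_ball_of_pos _ _ hs]
    simp [measureReal_def, hs.le]
  rw [this, Measure.volume_eq_prod, measureReal_prod_prod, hball,
    Real.volume_real_Ioc_of_le (by nlinarith), Real.rpow_add hs, Real.rpow_natCast, Real.rpow_two]
  ring

lemma cyl_subset_Qneg {R δ : ℝ} (hR : 0 < R) (hδ : 0 < δ) : cyl n R δ ⊆ Qneg n (2 * R) := by
  rintro q ⟨h1, h2, h3⟩
  refine ⟨?_, ?_, by linarith⟩
  · have : ‖q.1‖ ≤ R := by simpa using h1
    linarith
  · nlinarith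

lemma integrableOn_Qneg {h : Esp n × ℝ → ℝ} (hh : ContinuousOn h {q | q.2 ≤ 0}) (s : ℝ) :
    IntegrableOn h (Qneg n s) :=
  ((hh.mono fun _ hq => hq.2.2).integrableOn_compact
    ((isCompact_closedBall _ _).prod isCompact_Icc)).mono_set (Qneg_subset s)

/-- Comparison of powers: a smaller power is controlled by a larger one at any scale. -/
lemma rpow_le_add_rpow {a l p q : ℝ} (ha : 0 ≤ a) (hl : 0 < l) (hq : 0 ≤ q) (hqp : q ≤ p) :
    a ^ q ≤ l ^ q + l ^ (q - p) * a ^ p := by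
  rcases le_total a l with h | h
  · have := Real.rpow_le_rpow ha h hq
    have : 0 ≤ l ^ (q - p) * a ^ p := by positivity
    linarith
  · have ha0 : 0 < a := hl.trans_le h
    have h1 : a ^ (q - p) ≤ l ^ (q - p) :=
      Real.rpow_le_rpow_of_nonpos hl h (by linarith)
    have h2 : a ^ q = a ^ (q - p) * a ^ p := by
      rw [← Real.rpow_add ha0]; ring_nf
    have : a ^ (q - p) * a ^ p ≤ l ^ (q - p) * a ^ p := by gcongr
    have : 0 ≤ l ^ q := by positivity
    linarith

lemma growsAtMost_of_log_quadratic {p C : ℝ} (hp : 1 < p) (hC : 0 < C) {w : Esp n × ℝ → ℝ}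
    (hcont : ContinuousOn w {q : Esp n × ℝ | q.2 ≤ 0})
    (hgrowth : ∀ s : ℝ, 1 ≤ s →
      (s ^ (-((n : ℝ) + 2 + 2 * p)) * ∫ q in Qneg n s, |w q| ^ p) ^ (1 / p) ≤
        C * Real.log (2 * s)) {q : ℝ} (hq : 0 < q) (hqp : q ≤ p) :
    GrowsAtMost q (5 / 2) w := by
  have hp0 : 0 < p := by linarith
  set V := volume.real (Metric.ball (0 : Esp n) 1) with hV
  have hcontp : ∀ r : ℝ, 0 ≤ r → ContinuousOn (fun z => |w z| ^ r) {q : Esp n × ℝ | q.2 ≤ 0} :=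
    fun r hr => hcont.abs.rpow_const fun _ _ => Or.inr hr
  have hLp : ∀ s : ℝ, 1 ≤ s → ∫ z in Qneg n s, |w z| ^ p ≤
      (C * 4) ^ p * (s ^ ((n : ℝ) + 2) * (s ^ (5 / 2 : ℝ)) ^ p) := by
    intro s hs
    have hs0 : 0 < s := by linarith
    have hI : 0 ≤ ∫ z in Qneg n s, |w z| ^ p := integral_nonneg fun _ => by positivity
    have hlog : C * Real.log (2 * s) ≤ C * 4 * s ^ (1 / 2 : ℝ) := by
      rw [mul_assoc]
      gcongr
      refine (Real.log_le_rpow_div (by positivity) (ε := 1 / 2) (by norm_num)).trans ?_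
      rw [Real.mul_rpow zero_le_two hs0.le]
      have : (2 : ℝ) ^ (1 / 2 : ℝ) ≤ 2 ^ (1 : ℝ) :=
        Real.rpow_le_rpow_of_exponent_le one_le_two (by norm_num)
      rw [Real.rpow_one] at this
      have : 0 < s ^ (1 / 2 : ℝ) := by positivity
      rw [div_le_iff₀ (by norm_num)]
      nlinarith
    have h := (hgrowth s hs).trans hlog
    have h2 := Real.rpow_le_rpow (by positivity) h hp0.le
    rw [← Real.rpow_mul (by positivity), one_div_mul_cancel hp0.ne', Real.rpow_one,
      Real.rpow_neg hs0.le, inv_mul_le_iff₀ (by positivity),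
      Real.mul_rpow (by positivity) (by positivity)] at h2
    refine h2.trans (le_of_eq ?_)
    rw [← Real.rpow_mul hs0.le, ← Real.rpow_mul hs0.le, ← Real.rpow_add hs0, mul_left_comm,
      ← Real.rpow_add hs0]
    ring_nf
  have hLq : ∀ s : ℝ, 1 ≤ s → ∫ z in Qneg n s, |w z| ^ q ≤
      (V + (C * 4) ^ p) * s ^ ((n : ℝ) + 2 + 5 / 2 * q) := by
    intro s hs
    have hs0 : 0 < s := by linarith
    set l := s ^ (5 / 2 : ℝ) with hl
    have hl0 : 0 < l := by positivity
    have hip := integrableOn_Qneg (hcontp p hp0.le) s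
    have hiq := integrableOn_Qneg (hcontp q hq.le) s
    have hic : IntegrableOn (fun _ : Esp n × ℝ => l ^ q) (Qneg n s) :=
      integrableOn_Qneg continuousOn_const s
    calc ∫ z in Qneg n s, |w z| ^ q
        ≤ ∫ z in Qneg n s, (l ^ q + l ^ (q - p) * |w z| ^ p) :=
          setIntegral_mono_on hiq (hic.add (hip.const_mul _)) (measurableSet_Qneg s)
            fun z _ => rpow_le_add_rpow (abs_nonneg _) hl0 hq.le hqp
      _ = s ^ ((n : ℝ) + 2) * V * l ^ q + l ^ (q - p) * ∫ z in Qneg n s, |w z| ^ p := by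
          rw [integral_add hic (hip.const_mul _), setIntegral_const, integral_const_mul,
            volume_real_Qneg hs0, smul_eq_mul]
      _ ≤ s ^ ((n : ℝ) + 2) * V * l ^ q +
            l ^ (q - p) * ((C * 4) ^ p * (s ^ ((n : ℝ) + 2) * l ^ p)) := by
          gcongr
          exact hLp s hs
      _ = (V + (C * 4) ^ p) * s ^ ((n : ℝ) + 2 + 5 / 2 * q) := by
          rw [Real.rpow_sub hl0, Real.rpow_add hs0 _ (5 / 2 * q), Real.rpow_mul hs0.le, ← hl]
          have : l ^ p ≠ 0 := by positivity
          field_simp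
  refine ⟨(V + (C * 4) ^ p) * 2 ^ ((n : ℝ) + 2 + 5 / 2 * q), fun R δ hR hδ => ?_⟩
  have hR0 : 0 < R := by linarith
  refine (setIntegral_mono_set (integrableOn_Qneg (hcontp q hq.le) (2 * R))
    (Eventually.of_forall fun _ => by positivity)
    (cyl_subset_Qneg hR0 hδ).eventuallyLE).trans ((hLq (2 * R) (by linarith)).trans ?_)
  rw [Real.mul_rpow zero_le_two hR0.le, mul_assoc]

lemma hasDerivAt_space_line {u : Esp n × ℝ → ℝ} {q : Esp n × ℝ} (hu : DifferentiableAt ℝ u q)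
    (i : Fin n) :
    HasDerivAt (fun s : ℝ => u (q.1 + s • EuclideanSpace.single i (1 : ℝ), q.2))
      (dirDeriv (spaceDir i) u q) 0 := by
  have h1 : HasDerivAt (fun s : ℝ => (q.1 + s • EuclideanSpace.single i (1 : ℝ), q.2))
      (spaceDir i) 0 := by
    have := (((hasDerivAt_id (0 : ℝ)).smul_const (EuclideanSpace.single i (1 : ℝ))).const_add
      q.1).prodMk (hasDerivAt_const (0 : ℝ) q.2)
    simpa [spaceDir] using this
  have h2 : HasFDerivAt u (fderiv ℝ u q)
      (q.1 + (0 : ℝ) • EuclideanSpace.single i (1 : ℝ), q.2) := by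
    simpa using hu.hasFDerivAt
  exact h2.comp_hasDerivAt 0 h1

lemma hasDerivAt_time_line {u : Esp n × ℝ → ℝ} {q : Esp n × ℝ} (hu : DifferentiableAt ℝ u q) :
    HasDerivAt (fun t : ℝ => u (q.1, t)) (dirDeriv (timeDir n) u q) q.2 :=
  HasFDerivAt.comp_hasDerivAt (f := fun t : ℝ => (q.1, t)) q.2 hu.hasFDerivAt
    ((hasDerivAt_const q.2 q.1).prodMk (hasDerivAt_id q.2))

lemma pderiv'_eq_dirDeriv {u : Esp n × ℝ → ℝ} (hu : ContDiffOn ℝ (⊤ : ℕ∞) u (past n))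
    (i : Fin n) {t : ℝ} (ht : t < 0) :
    pderiv' i (fun x => u (x, t)) = fun x => dirDeriv (spaceDir i) u (x, t) :=
  funext fun x => (hasDerivAt_space_line (q := (x, t)) (differentiableAt_of_mem hu ht) i).deriv

lemma heatOp_eq {u : Esp n × ℝ → ℝ} (hu : ContDiffOn ℝ (⊤ : ℕ∞) u (past n))
    {q : Esp n × ℝ} (hq : q ∈ past n) :
    heatOp u q = ∑ i, dirDeriv (spaceDir i) (dirDeriv (spaceDir i) u) q -
      dirDeriv (timeDir n) u q := by
  have hq' : q.2 < 0 := hq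
  rw [heatOp, lapl, (hasDerivAt_time_line (differentiableAt_of_mem hu hq)).deriv]
  simp only [pderiv'_eq_dirDeriv hu _ hq',
    pderiv'_eq_dirDeriv (contDiffOn_dirDeriv _ hu) _ hq']

lemma isCaloric_of_heatOp {u : Esp n × ℝ → ℝ} (hu : ContDiffOn ℝ (⊤ : ℕ∞) u (past n))
    (h : ∀ q ∈ past n, heatOp u q = 0) : IsCaloric u :=
  ⟨hu, fun q hq => by rw [← sub_eq_zero, ← heatOp_eq hu hq, h q hq]⟩

lemma dirDeriv_sub_of_mem {g h : Esp n × ℝ → ℝ} (e : Esp n × ℝ) {q : Esp n × ℝ}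
    (hg : DifferentiableAt ℝ g q) (hh : DifferentiableAt ℝ h q) :
    dirDeriv e (fun z => g z - h z) q = dirDeriv e g q - dirDeriv e h q := by
  simp [dirDeriv, fderiv_fun_sub hg hh]

lemma hasFDerivAt_coord (j : Fin n) (q : Esp n × ℝ) :
    HasFDerivAt (fun z : Esp n × ℝ => z.1 j)
      ((EuclideanSpace.proj j : Esp n →L[ℝ] ℝ) ∘L ContinuousLinearMap.fst ℝ (Esp n) ℝ) q :=
  ((EuclideanSpace.proj j : Esp n →L[ℝ] ℝ) ∘L
    ContinuousLinearMap.fst ℝ (Esp n) ℝ).hasFDerivAt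

lemma dirDeriv_linear (e : Esp n × ℝ) (c : Fin n → ℝ) (q : Esp n × ℝ) :
    dirDeriv e (fun z => ∑ j, c j * z.1 j) q = ∑ j, c j * e.1 j := by
  have := HasFDerivAt.fun_sum (u := Finset.univ)
    fun j _ => (hasFDerivAt_coord (n := n) j q).const_mul (c j)
  rw [dirDeriv, this.fderiv]
  simp

lemma dirDeriv_quadratic (e : Esp n × ℝ) (M : Fin n → Fin n → ℝ) (q : Esp n × ℝ) :
    dirDeriv e (fun z => ∑ i, ∑ j, M i j * z.1 i * z.1 j) q =
      ∑ i, ∑ j, M i j * (e.1 i * q.1 j + q.1 i * e.1 j) := by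
  have := HasFDerivAt.fun_sum (u := Finset.univ) fun i _ =>
    HasFDerivAt.fun_sum (u := Finset.univ) fun j _ =>
      ((hasFDerivAt_coord (n := n) i q).const_mul (M i j)).fun_mul (hasFDerivAt_coord j q)
  rw [dirDeriv, this.fderiv]
  simp only [sum_apply, add_apply,
    smul_apply, ContinuousLinearMap.comp_apply, smul_eq_mul]
  refine Finset.sum_congr rfl fun i _ => Finset.sum_congr rfl fun j _ => ?_
  simp
  ring

/-- The polynomial `b·x + ½ xᵀMx + mt`. -/
def quadPoly (m : ℝ) (b : Fin n → ℝ) (M : Fin n → Fin n → ℝ) (q : Esp n × ℝ) : ℝ :=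
  (∑ i, b i * q.1 i) + 1 / 2 * (∑ i, ∑ j, M i j * q.1 i * q.1 j) + m * q.2

lemma contDiff_linear (b : Fin n → ℝ) :
    ContDiff ℝ (⊤ : ℕ∞) (fun q : Esp n × ℝ => ∑ i, b i * q.1 i) := by
  fun_prop

lemma contDiff_quadratic (M : Fin n → Fin n → ℝ) :
    ContDiff ℝ (⊤ : ℕ∞) (fun q : Esp n × ℝ => ∑ i, ∑ j, M i j * q.1 i * q.1 j) := by
  fun_prop

lemma contDiff_quadPoly (m : ℝ) (b : Fin n → ℝ) (M : Fin n → Fin n → ℝ) :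
    ContDiff ℝ (⊤ : ℕ∞) (quadPoly m b M) :=
  ((contDiff_linear b).add (contDiff_const.mul (contDiff_quadratic M))).add
    (contDiff_const.mul contDiff_snd)

lemma dirDeriv_quadPoly (e : Esp n × ℝ) (m : ℝ) (b : Fin n → ℝ) (M : Fin n → Fin n → ℝ)
    (q : Esp n × ℝ) :
    dirDeriv e (quadPoly m b M) q = (∑ i, b i * e.1 i) +
      1 / 2 * (∑ i, ∑ j, M i j * (e.1 i * q.1 j + q.1 i * e.1 j)) + m * e.2 := by
  have h1 := ((contDiff_linear b).differentiable (by simp)) q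
  have h2 := ((contDiff_quadratic M).differentiable (by simp)) q
  have h3 : DifferentiableAt ℝ (fun q : Esp n × ℝ => m * q.2) q := by fun_prop
  have h4 : HasFDerivAt (fun q : Esp n × ℝ => m * q.2)
      (m • ContinuousLinearMap.snd ℝ (Esp n) ℝ) q :=
    hasFDerivAt_snd.const_mul m
  rw [← dirDeriv_linear e b q, ← dirDeriv_quadratic e M q]
  have h := (h1.hasFDerivAt.add (h2.hasFDerivAt.const_mul (1 / 2))).add h4
  have : HasFDerivAt (quadPoly m b M) _ q := h
  rw [dirDeriv, this.fderiv]
  simp [dirDeriv]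

/-- A caloric function whose third spatial derivatives vanish is a caloric quadratic
polynomial. -/
lemma IsCaloric.exists_eq_quadPoly {v : Esp n × ℝ → ℝ} (hv : IsCaloric v)
    (h3 : ∀ k i j, ∀ q ∈ past n, CaloricLiouville.dirDeriv (spaceDir k)
      (CaloricLiouville.dirDeriv (spaceDir i) (CaloricLiouville.dirDeriv (spaceDir j) v)) q = 0) :
    ∃ (a : ℝ) (b : Fin n → ℝ) (M : Fin n → Fin n → ℝ), (∀ i j, M i j = M j i) ∧
      ∀ q ∈ past n, v q = a + quadPoly (∑ i, M i i) b M q := by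
  have hM := fun i j => ((hv.dirDeriv (spaceDir j)).dirDeriv (spaceDir i)).exists_eq_const
    fun k => h3 k i j
  choose M hM using hM
  have h0 : ((0, -1) : Esp n × ℝ) ∈ past n := by simp [past]
  have hsymm : ∀ i j, M i j = M j i := fun i j => by
    rw [← hM i j _ h0, ← hM j i _ h0]
    exact dirDeriv_comm hv.contDiffOn _ _ h0
  have hb : ∀ i, ∃ c, ∀ q ∈ past n,
      CaloricLiouville.dirDeriv (spaceDir i) v q - ∑ j, M i j * q.1 j = c := fun i => by
    have hd := contDiffOn_dirDeriv (spaceDir i) hv.contDiffOn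
    have hlin := contDiff_linear (M i)
    have hsub : ∀ e, ∀ q ∈ past n, CaloricLiouville.dirDeriv e
        (fun q => CaloricLiouville.dirDeriv (spaceDir i) v q - ∑ j, M i j * q.1 j) q =
        CaloricLiouville.dirDeriv e (CaloricLiouville.dirDeriv (spaceDir i) v) q -
          ∑ j, M i j * e.1 j := fun e q hq => by
      rw [dirDeriv_sub_of_mem e (differentiableAt_of_mem hd hq)
        (hlin.differentiable (by simp) q), dirDeriv_linear]
    refine CaloricLiouville.exists_eq_const (hd.sub hlin.contDiffOn) (fun k q hq => ?_)
      fun q hq => ?_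
    · rw [hsub _ q hq, hM k i q hq, hsymm k i]
      simp [spaceDir]
    · rw [hsub _ q hq, ← (hv.dirDeriv (spaceDir i)).heat q hq,
        Finset.sum_eq_zero fun k _ => h3 k k i q hq]
      simp [timeDir]
  choose b hb using hb
  have hP := contDiff_quadPoly (∑ i, M i i) b M
  have hsub : ∀ e, ∀ q ∈ past n, CaloricLiouville.dirDeriv e
      (fun q => v q - quadPoly (∑ i, M i i) b M q) q =
      CaloricLiouville.dirDeriv e v q - CaloricLiouville.dirDeriv e
        (quadPoly (∑ i, M i i) b M) q := fun e q hq =>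
    dirDeriv_sub_of_mem e (differentiableAt_of_mem hv.contDiffOn hq)
      (hP.differentiable (by simp) q)
  obtain ⟨a, ha⟩ := CaloricLiouville.exists_eq_const (hv.contDiffOn.sub hP.contDiffOn)
    (fun k q hq => by
      have hbk := hb k q hq
      have hsym : ∑ i, M i k * q.1 i = ∑ i, M k i * q.1 i :=
        Finset.sum_congr rfl fun i _ => by rw [hsymm i k]
      rw [hsub _ q hq, dirDeriv_quadPoly]
      simp only [spaceDir, PiLp.single_apply, mul_add, Finset.sum_add_distrib, mul_ite, ite_mul,
        mul_one, one_mul, mul_zero, zero_mul, Finset.sum_ite_eq',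
        Finset.mem_univ, if_true] at hbk ⊢
      rw [Finset.sum_comm]
      simp only [Finset.sum_ite_eq', Finset.mem_univ, if_true]
      linarith)
    (fun q hq => by
      rw [hsub _ q hq, dirDeriv_quadPoly, ← hv.heat q hq,
        Finset.sum_congr rfl fun i _ => hM i i q hq]
      simp [timeDir])
  exact ⟨a, b, M, hsymm, fun q hq => by rw [← ha q hq]; ring⟩

/-- An identity of continuous functions on the open past extends to time zero by continuity. -/
lemma eqOn_of_eqOn_past {u v : Esp n × ℝ → ℝ} (hu : ContinuousOn u {q | q.2 ≤ 0})
    (hv : Continuous v) (h : EqOn u v (past n)) : EqOn u v {q | q.2 ≤ 0} := by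
  refine h.of_subset_closure hu hv.continuousOn (fun q hq => le_of_lt (show q.2 < 0 from hq)) ?_
  have : closure (past n) = {q | q.2 ∈ closure (Iio (0 : ℝ))} :=
    (isOpenMap_snd.preimage_closure_eq_closure_preimage continuous_snd (Iio (0 : ℝ))).symm
  rw [this, closure_Iio]
  exact fun q hq => hq

end CaloricLiouville

/-- Liouville-type theorem: a caloric function on `ℝⁿ × (-∞,0)` with parabolic
quadratic growth up to a logarithmic factor is a caloric polynomial of degree at most 2
in space and 1 in time. -/
theorem liouville_caloric_log_quadratic (n : ℕ) (p C : ℝ) (hp : 1 < p) (hC : 0 < C)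
    (w : Esp n × ℝ → ℝ)
    (hsmooth : ContDiffOn ℝ (⊤ : ℕ∞) w {q : Esp n × ℝ | q.2 < 0})
    (hcont : ContinuousOn w {q : Esp n × ℝ | q.2 ≤ 0})
    (hcaloric : ∀ q : Esp n × ℝ, q.2 < 0 → heatOp w q = 0)
    (hgrowth : ∀ s : ℝ, 1 ≤ s →
      (s ^ (-((n:ℝ) + 2 + 2*p)) * ∫ q in Qneg n s, |w q| ^ p) ^ (1/p) ≤
        C * Real.log (2*s)) :
    ∃ (a m : ℝ) (b : Esp n) (M : Matrix (Fin n) (Fin n) ℝ),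
      M.transpose = M ∧ Matrix.trace M = m ∧
      ∀ (x : Esp n) (t : ℝ), t ≤ 0 → w (x, t) =
        a + (∑ i, b i * x i) + (1/2) * (∑ i, ∑ j, M i j * x i * x j) + m * t := by
  have hq1 : 1 < min p 2 := lt_min hp one_lt_two
  have hw := CaloricLiouville.isCaloric_of_heatOp hsmooth hcaloric
  have hg := CaloricLiouville.growsAtMost_of_log_quadratic hp hC hcont hgrowth
    (by linarith : 0 < min p 2) (min_le_left p 2)
  obtain ⟨a, b, M, hM, hP⟩ := hw.exists_eq_quadPoly fun k i j =>
    (((hw.dirDeriv _).dirDeriv _).dirDeriv _).eq_zero_of_growsAtMost hq1 (min_le_right p 2)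
      (((hg.dirDeriv hq1 (min_le_right p 2) hw j).dirDeriv hq1 (min_le_right p 2)
        (hw.dirDeriv _) i).dirDeriv hq1 (min_le_right p 2) ((hw.dirDeriv _).dirDeriv _) k)
      (by norm_num)
  refine ⟨a, ∑ i, M i i, WithLp.toLp 2 b, Matrix.of M, ?_, rfl, fun x t ht => ?_⟩
  · ext i j
    exact hM j i
  · rw [CaloricLiouville.eqOn_of_eqOn_past hcont (continuous_const.add
      (CaloricLiouville.contDiff_quadPoly _ b M).continuous) hP (x := (x, t)) ht]
    simp only [Pi.add_apply, CaloricLiouville.quadPoly, Matrix.of_apply]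
    ring
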